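/- arXiv:math/0608603 — 2 statements merged into one kernel-verified Lean document; each statement's English description precedes it below -/
import Mathlib

section
/- A recurrent right-infinite word over a finite alphabet is uniformly recurrent if and only if the set of return words of every factor is finite. -/
variable {A : Type*}

/-- The factor of `u` of length `n` starting at position `j`. -/
def factorAt (u : ℕ → A) (j n : ℕ) : List A :=
  (List.range n).map (fun i => u (j + i))

/-- `j` is an occurrence of the finite word `w` in `u`. -/
def OccursAt (u : ℕ → A) (w : List A) (j : ℕ) : Prop :=
  factorAt u j w.length = w

/-- `w` is a factor of the infinite word `u`. -/
def IsFactor (u : ℕ → A) (w : List A) : Prop :=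
  ∃ j, OccursAt u w j

/-- `v` is a return word of `w` in `u`: the word between two successive occurrences of `w`. -/
def IsReturnWord (u : ℕ → A) (w v : List A) : Prop :=
  ∃ j k, j < k ∧ OccursAt u w j ∧ OccursAt u w k ∧
    (∀ l, j < l → l < k → ¬ OccursAt u w l) ∧ v = factorAt u j (k - j)

/-- The set `R(w)` of return words of `w` in `u`. -/
def returnWords (u : ℕ → A) (w : List A) : Set (List A) :=
  {v | IsReturnWord u w v}

/-- Property `R_m`: every factor of `u` has exactly `m` return words. -/
def PropertyR (u : ℕ → A) (m : ℕ) : Prop :=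
  ∀ w, IsFactor u w → (returnWords u w).Finite ∧ (returnWords u w).ncard = m

/-- The set of left extensions of `w`. -/
def leftExt (u : ℕ → A) (w : List A) : Set A := {a | IsFactor u (a :: w)}

/-- The set of right extensions of `w`. -/
def rightExt (u : ℕ → A) (w : List A) : Set A := {b | IsFactor u (w ++ [b])}

def LeftSpecial (u : ℕ → A) (w : List A) : Prop := 2 ≤ (leftExt u w).ncard

def RightSpecial (u : ℕ → A) (w : List A) : Prop := 2 ≤ (rightExt u w).ncard

/-- The set of pairs `(a, b)` such that `a w b` is a factor of `u`. -/
def extPairs (u : ℕ → A) (w : List A) : Set (A × A) :=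
  {p | IsFactor u (p.1 :: (w ++ [p.2]))}

/-- The bilateral order `B(w)`. -/
noncomputable def bilateralOrder (u : ℕ → A) (w : List A) : ℤ :=
  ((extPairs u w).ncard : ℤ) - (leftExt u w).ncard - (rightExt u w).ncard + 1

/-- `w` is a weak bispecial factor of `u`. -/
def WeakBispecial (u : ℕ → A) (w : List A) : Prop :=
  IsFactor u w ∧ bilateralOrder u w < 0

/-- The factor complexity of `u`. -/
noncomputable def Complexity (u : ℕ → A) (n : ℕ) : ℕ :=
  {w : List A | w.length = n ∧ IsFactor u w}.ncard

/-- `u` is recurrent: every factor occurs at least twice. -/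
def Recurrent (u : ℕ → A) : Prop :=
  ∀ w, IsFactor u w → ∃ j k, j < k ∧ OccursAt u w j ∧ OccursAt u w k

/-- `u` is uniformly recurrent. -/
def UniformlyRecurrent (u : ℕ → A) : Prop :=
  ∀ n : ℕ, ∃ N : ℕ, ∀ w, IsFactor u w → w.length = N →
    ∀ v, IsFactor u v → v.length = n → v <:+: w

def EventuallyPeriodic (u : ℕ → A) : Prop :=
  ∃ p, 0 < p ∧ ∃ N, ∀ n, N ≤ n → u (n + p) = u n

/-- `w` is a maximal right special factor. -/
def MaximalRightSpecial (u : ℕ → A) (w : List A) : Prop :=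
  IsFactor u w ∧ RightSpecial u w ∧
    ∀ v, IsFactor u v → RightSpecial u v → w <:+ v → v = w

/-- The return word `v` of `w` starts with the letter `b`. -/
def StartsWithLetter (w v : List A) (b : A) : Prop := (w ++ [b]) <+: (v ++ w)

theorem length_factorAt (u : ℕ → A) (j n : ℕ) : (factorAt u j n).length = n := by
  simp [factorAt]

theorem factorAt_add (u : ℕ → A) (j m n : ℕ) :
    factorAt u j (m + n) = factorAt u j m ++ factorAt u (j + m) n := by
  simp [factorAt, List.range_add, Function.comp_def, Nat.add_assoc]

theorem occursAt_factorAt (u : ℕ → A) (j n : ℕ) : OccursAt u (factorAt u j n) j := by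
  simp [OccursAt, length_factorAt]

theorem OccursAt.append_right {u : ℕ → A} {v w : List A} {j : ℕ}
    (h : OccursAt u (v ++ w) j) : OccursAt u w (j + v.length) := by
  rw [OccursAt, List.length_append, factorAt_add] at h
  exact (List.append_inj h (length_factorAt _ _ _)).2

theorem OccursAt.append_left {u : ℕ → A} {v w : List A} {j : ℕ}
    (h : OccursAt u (v ++ w) j) : OccursAt u v j := by
  rw [OccursAt, List.length_append, factorAt_add] at h
  exact (List.append_inj h (length_factorAt _ _ _)).1

/-- The infixes of a window of `u` are the words that occur inside this window. -/
theorem infix_factorAt_iff {u : ℕ → A} {v : List A} {j N : ℕ} :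
    v <:+: factorAt u j N ↔ ∃ l, j ≤ l ∧ l + v.length ≤ j + N ∧ OccursAt u v l := by
  constructor
  · rintro ⟨s, t, h⟩
    have hocc : OccursAt u (s ++ v ++ t) j := h ▸ occursAt_factorAt u j N
    have hlen := congrArg List.length h
    simp only [List.length_append, length_factorAt] at hlen
    exact ⟨j + s.length, by lia, by lia, hocc.append_left.append_right⟩
  · rintro ⟨l, hjl, hlN, hocc⟩
    refine ⟨factorAt u j (l - j), factorAt u (l + v.length) (j + N - (l + v.length)), ?_⟩
    have hN : N = (l - j) + v.length + (j + N - (l + v.length)) := by lia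
    conv_rhs => rw [hN, factorAt_add, factorAt_add]
    rw [show j + (l - j) = l by lia, show j + (l - j + v.length) = l + v.length by lia, hocc]

theorem Recurrent.exists_occursAt_gt {u : ℕ → A} (hrec : Recurrent u) {w : List A}
    (hw : IsFactor u w) (n : ℕ) : ∃ k, n < k ∧ OccursAt u w k := by
  have hnext : ∀ p, OccursAt u w p → ∃ q, p < q ∧ OccursAt u w q := by
    intro p hp
    have hpre : OccursAt u (factorAt u 0 p ++ w) 0 := by
      simp [OccursAt, factorAt_add, length_factorAt, show factorAt u p w.length = w from hp]
    obtain ⟨a, b, hab, -, hb⟩ := hrec _ ⟨0, hpre⟩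
    have hb' := hb.append_right
    rw [length_factorAt] at hb'
    exact ⟨b + p, by lia, hb'⟩
  induction n with
  | zero =>
    obtain ⟨p, hp⟩ := hw
    obtain ⟨q, hpq, hq⟩ := hnext p hp
    exact ⟨q, by lia, hq⟩
  | succ n ih =>
    obtain ⟨k, hk, hocc⟩ := ih
    obtain ⟨q, hkq, hq⟩ := hnext k hocc
    exact ⟨q, by lia, hq⟩

theorem UniformlyRecurrent.returnWords_finite [Finite A] {u : ℕ → A}
    (hu : UniformlyRecurrent u) {w : List A} (hw : IsFactor u w) : (returnWords u w).Finite := by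
  obtain ⟨N, hN⟩ := hu w.length
  refine (List.finite_length_le A (N + 1)).subset ?_
  rintro v ⟨j, k, hjk, -, -, hno, rfl⟩
  obtain ⟨l, hjl, hlN, hocc⟩ := infix_factorAt_iff.1 <|
    hN (factorAt u (j + 1) N) ⟨_, occursAt_factorAt _ _ _⟩ (length_factorAt _ _ _) w hw rfl
  have hkl : ¬ l < k := fun h => hno l (by lia) h hocc
  simp only [Set.mem_ofPred_eq, length_factorAt]
  lia

/-- A factor with finitely many return words occurs in every sufficiently long window. -/
theorem Recurrent.exists_forall_infix {u : ℕ → A} (hrec : Recurrent u) {w : List A}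
    (hw : IsFactor u w) (hfin : (returnWords u w).Finite) :
    ∃ M, ∀ N, M ≤ N → ∀ j, w <:+: factorAt u j N := by
  classical
  obtain ⟨B, hB⟩ := (hfin.image List.length).bddAbove
  obtain ⟨p, hp⟩ := hw
  refine ⟨p + B + w.length, fun N hN j => infix_factorAt_iff.2 ?_⟩
  obtain hjp | hpj := le_total j p
  · exact ⟨p, hjp, by lia, hp⟩
  set l := Nat.findGreatest (OccursAt u w) j with hl
  have hlocc : OccursAt u w l := Nat.findGreatest_spec hpj hp
  have hlj : l ≤ j := Nat.findGreatest_le j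
  have hex := hrec.exists_occursAt_gt ⟨p, hp⟩ j
  obtain ⟨hjk, hkocc⟩ := Nat.find_spec hex
  set k := Nat.find hex with hk
  have hret : factorAt u l (k - l) ∈ returnWords u w := by
    refine ⟨l, k, by lia, hlocc, hkocc, fun m hlm hmk hm => ?_, rfl⟩
    obtain hmj | hjm := le_or_gt m j
    · exact Nat.findGreatest_is_greatest hlm hmj hm
    · exact Nat.find_min hex hmk ⟨hjm, hm⟩
  have hkB := hB (Set.mem_image_of_mem _ hret)
  rw [length_factorAt] at hkB
  exact ⟨k, hjk.le, by lia, hkocc⟩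

theorem Recurrent.uniformlyRecurrent_of_returnWords_finite [Finite A] {u : ℕ → A}
    (hrec : Recurrent u) (hfin : ∀ w, IsFactor u w → (returnWords u w).Finite) :
    UniformlyRecurrent u := by
  intro n
  have hM : ∀ v, ∃ M, IsFactor u v → ∀ N, M ≤ N → ∀ j, v <:+: factorAt u j N := by
    intro v
    by_cases hv : IsFactor u v
    · obtain ⟨M, hM⟩ := hrec.exists_forall_infix hv (hfin v hv)
      exact ⟨M, fun _ => hM⟩
    · exact ⟨0, fun h => absurd h hv⟩
  choose M hM using hM
  obtain ⟨N, hN⟩ := ((List.finite_length_eq A n).image M).bddAbove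
  refine ⟨N, fun w ⟨j, hj⟩ hwN v hv hvn => ?_⟩
  rw [← hj, hwN]
  exact hM v hv N (hN (Set.mem_image_of_mem _ hvn)) j

/-- A recurrent right-infinite word over a finite alphabet is uniformly
recurrent if and only if the set of return words of every factor is finite. -/
theorem uniformlyRecurrent_iff_returnWords_finite [Fintype A] (u : ℕ → A)
    (hrec : Recurrent u) :
    UniformlyRecurrent u ↔ ∀ w, IsFactor u w → (returnWords u w).Finite := by
  exact ⟨fun hu _ hw => hu.returnWords_finite hw,
    hrec.uniformlyRecurrent_of_returnWords_finite⟩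
end

section
/- Let u be a uniformly recurrent infinite word with no weak bispecial factor such that ΔC(n) < m for all n ≥ 0, where ΔC(n) = C(n+1) − C(n). Then #R(w) ≤ m for every factor w of u. -/
variable {A : Type*}

open Finset in
theorem sum_card_fiber_eq {α β : Type*} [DecidableEq β] (S : Finset α) (T : Finset β) (g : α → β)
    (hg : ∀ a ∈ S, g a ∈ T) : (#S : ℤ) = ∑ b ∈ T, (#{a ∈ S | g a = b} : ℤ) := by
  exact_mod_cast Finset.card_eq_sum_card_fiberwise (f := g) (fun a ha => hg a ha)

theorem occursAt_append_iff {u : ℕ → A} {s t : List A} {j : ℕ} :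
    OccursAt u (s ++ t) j ↔ OccursAt u s j ∧ OccursAt u t (j + s.length) := by
  unfold OccursAt
  rw [List.length_append, factorAt_add]
  constructor
  · intro h
    exact List.append_inj h (length_factorAt _ _ _)
  · rintro ⟨h₁, h₂⟩
    rw [h₁, h₂]

theorem OccursAt.prefix_of_length_le {u : ℕ → A} {s t : List A} {j : ℕ} (hs : OccursAt u s j)
    (ht : OccursAt u t j) (h : s.length ≤ t.length) : s <+: t := by
  obtain ⟨d, hd⟩ := Nat.exists_eq_add_of_le h
  unfold OccursAt at hs ht
  rw [hd, factorAt_add, hs] at ht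
  exact ⟨_, ht⟩

theorem IsFactor.of_infix {u : ℕ → A} {s t : List A} (h : IsFactor u t) (hst : s <:+: t) :
    IsFactor u s := by
  obtain ⟨p, q, rfl⟩ := hst
  obtain ⟨j, hj⟩ := h
  exact ⟨_, (occursAt_append_iff.1 (occursAt_append_iff.1 hj).1).2⟩

theorem IsFactor.rightExt_nonempty {u : ℕ → A} {w : List A} (h : IsFactor u w) :
    (rightExt u w).Nonempty := by
  obtain ⟨j, hj⟩ := h
  exact ⟨u (j + w.length), j, occursAt_append_iff.2 ⟨hj, by simp [OccursAt, factorAt]⟩⟩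

theorem finite_factors_length_eq [Finite A] (u : ℕ → A) (n : ℕ) :
    {w : List A | w.length = n ∧ IsFactor u w}.Finite :=
  (List.finite_length_eq A n).subset fun _ h => h.1

/-- The finset of factors of `u` of length `n`. -/
noncomputable def factorsOfLength [Finite A] (u : ℕ → A) (n : ℕ) : Finset (List A) :=
  (finite_factors_length_eq u n).toFinset

theorem mem_factorsOfLength [Finite A] {u : ℕ → A} {n : ℕ} {w : List A} :
    w ∈ factorsOfLength u n ↔ w.length = n ∧ IsFactor u w := by
  simp [factorsOfLength]

theorem complexity_eq_card [Finite A] (u : ℕ → A) (n : ℕ) :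
    Complexity u n = (factorsOfLength u n).card :=
  Set.ncard_eq_toFinset_card _ _

/-- The number of right extensions of `w` minus one. -/
noncomputable def rightExcess (u : ℕ → A) (w : List A) : ℤ := (rightExt u w).ncard - 1

theorem IsFactor.rightExcess_nonneg [Finite A] {u : ℕ → A} {w : List A} (h : IsFactor u w) :
    0 ≤ rightExcess u w := by
  have := (Set.ncard_pos (Set.toFinite _)).2 h.rightExt_nonempty
  unfold rightExcess
  omega

theorem ncard_image_concat (u : ℕ → A) (x : List A) :
    ((fun b => x ++ [b]) '' rightExt u x).ncard = (rightExt u x).ncard :=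
  Set.ncard_image_of_injective _ fun a b h => by simpa using h

theorem complexity_succ_sub [Finite A] (u : ℕ → A) (n : ℕ) :
    (Complexity u (n + 1) : ℤ) - Complexity u n = ∑ w ∈ factorsOfLength u n, rightExcess u w := by
  classical
  simp only [rightExcess, Finset.sum_sub_distrib, complexity_eq_card]
  rw [sum_card_fiber_eq (factorsOfLength u (n + 1)) (factorsOfLength u n) List.dropLast]
  · simp only [Finset.sum_const, nsmul_eq_mul, mul_one, sub_left_inj]
    refine Finset.sum_congr rfl fun x hx => ?_
    rw [← ncard_image_concat, ← Set.ncard_coe_finset]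
    congr 2
    ext z
    simp only [Finset.coe_filter, mem_factorsOfLength, Set.mem_ofPred_eq, Set.mem_image, rightExt]
    rw [mem_factorsOfLength] at hx
    constructor
    · rintro ⟨⟨h₁, h₂⟩, rfl⟩
      have hz : z ≠ [] := by rintro rfl; simp at h₁
      refine ⟨z.getLast hz, ?_, List.dropLast_append_getLast hz⟩
      rwa [List.dropLast_append_getLast hz]
    · rintro ⟨b, hb, rfl⟩
      simp [hb, hx.1]
  · intro z hz
    rw [mem_factorsOfLength] at hz ⊢
    exact ⟨by simp [hz.1], hz.2.of_infix (List.dropLast_prefix z).isInfix⟩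

theorem ncard_extPairs [Finite A] (u : ℕ → A) (w : List A) :
    ((extPairs u w).ncard : ℤ) =
      ∑ a ∈ (leftExt u w).toFinite.toFinset, ((rightExt u (a :: w)).ncard : ℤ) := by
  classical
  rw [Set.ncard_eq_toFinset_card _ (Set.toFinite _),
    sum_card_fiber_eq _ (leftExt u w).toFinite.toFinset Prod.fst]
  · refine Finset.sum_congr rfl fun a _ => ?_
    rw [← Set.ncard_image_of_injective (rightExt u (a :: w)) (Prod.mk_right_injective a),
      ← Set.ncard_coe_finset]
    congr 2
    ext ⟨c, b⟩
    simp only [Finset.coe_filter, Set.Finite.mem_toFinset, extPairs, rightExt, Set.mem_ofPred_eq,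
      Set.mem_image, Prod.mk.injEq, List.cons_append]
    constructor
    · rintro ⟨h, rfl⟩
      exact ⟨b, h, rfl, rfl⟩
    · rintro ⟨b, h, rfl, rfl⟩
      exact ⟨h, rfl⟩
  · rintro ⟨a, b⟩ h
    simp only [Set.Finite.mem_toFinset, extPairs, leftExt, Set.mem_ofPred_eq] at h ⊢
    exact h.of_infix ⟨[], [b], by simp⟩

theorem rightExcess_le_sum_leftExt [Finite A] {u : ℕ → A} {w : List A} (hw : IsFactor u w)
    (hwb : ¬ WeakBispecial u w) :
    rightExcess u w ≤ ∑ a ∈ (leftExt u w).toFinite.toFinset, rightExcess u (a :: w) := by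
  have h : 0 ≤ bilateralOrder u w := by
    by_contra h
    exact hwb ⟨hw, not_le.1 h⟩
  simp only [rightExcess, Finset.sum_sub_distrib]
  rw [← ncard_extPairs]
  rw [bilateralOrder, Set.ncard_eq_toFinset_card (leftExt u w) (Set.toFinite _)] at h
  simp only [Finset.sum_const, nsmul_eq_mul, mul_one]
  linarith

open scoped Classical in
/-- Without weak bispecial factors, right excess does not decrease when passing to all the left
prolongations of a given length. -/
theorem rightExcess_le_sum_suffix [Finite A] {u : ℕ → A} (hwb : ∀ w, ¬ WeakBispecial u w)
    {x : List A} (hx : IsFactor u x) {n : ℕ} (hn : x.length ≤ n) :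
    rightExcess u x ≤ ∑ z ∈ factorsOfLength u n with x <:+ z, rightExcess u z := by
  induction n, hn using Nat.le_induction with
  | base =>
    refine Finset.single_le_sum (f := rightExcess u) (fun z hz => ?_) ?_
    · exact (mem_factorsOfLength.1 (Finset.mem_filter.1 hz).1).2.rightExcess_nonneg
    · simp [mem_factorsOfLength, hx]
  | succ n hn ih =>
    refine ih.trans ?_
    have htail : ∀ z ∈ (factorsOfLength u (n + 1)).filter (x <:+ ·),
        z.tail ∈ (factorsOfLength u n).filter (x <:+ ·) := by
      intro z hz
      simp only [Finset.mem_filter, mem_factorsOfLength] at hz ⊢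
      obtain ⟨⟨h₁, h₂⟩, h₃⟩ := hz
      refine ⟨⟨by simp [h₁], h₂.of_infix (List.tail_suffix z).isInfix⟩, ?_⟩
      exact List.suffix_of_suffix_length_le h₃ (List.tail_suffix z) (by simp [h₁, hn])
    rw [← Finset.sum_fiberwise_of_maps_to htail]
    refine Finset.sum_le_sum fun y hy => ?_
    simp only [Finset.mem_filter, mem_factorsOfLength] at hy
    refine (rightExcess_le_sum_leftExt hy.1.2 (hwb y)).trans (le_of_eq ?_)
    refine Finset.sum_bij (fun a _ => a :: y) ?_ ?_ ?_ ?_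
    · intro a ha
      simp only [Set.Finite.mem_toFinset, leftExt, Set.mem_ofPred_eq] at ha
      simp only [Finset.mem_filter, mem_factorsOfLength]
      exact ⟨⟨⟨by simp [hy.1.1], ha⟩, hy.2.trans (List.suffix_cons a y)⟩, rfl⟩
    · intro a _ b _ h
      simpa using h
    · intro z hz
      simp only [Finset.mem_filter, mem_factorsOfLength] at hz
      obtain ⟨⟨⟨h₁, h₂⟩, _⟩, rfl⟩ := hz
      cases z with
      | nil => simp at h₁
      | cons a z => exact ⟨a, by simpa [leftExt] using h₂, rfl⟩
    · intros
      rfl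

/-- The factors of `u` in which `w` occurs exactly once, namely as a prefix. -/
def prefixOnlyFactors (u : ℕ → A) (w : List A) : Set (List A) :=
  {x | IsFactor u x ∧ w <+: x ∧ ∀ t, t <:+ x → w <+: t → t = x}

theorem UniformlyRecurrent.exists_length_le {u : ℕ → A} (hur : UniformlyRecurrent u) {w : List A}
    (hw : IsFactor u w) : ∃ N, ∀ x ∈ prefixOnlyFactors u w, x.length ≤ N := by
  obtain ⟨N, hN⟩ := hur w.length
  refine ⟨N, fun x ⟨hx, _, huniq⟩ => ?_⟩
  by_contra! hlt
  have hsuff : x.drop (x.length - N) <:+ x := List.drop_suffix _ _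
  obtain ⟨p, q, hpq⟩ := hN _ (hx.of_infix hsuff.isInfix) (by simp; omega) w hw rfl
  have hs : w ++ q <:+ x.drop (x.length - N) := ⟨p, by simpa using hpq⟩
  have h := congrArg List.length (huniq _ (hs.trans hsuff) (List.prefix_append _ _))
  have := hs.length_le
  simp only [List.length_drop] at this
  omega

theorem dropLast_mem_prefixOnlyFactors {u : ℕ → A} {w x : List A}
    (hx : x ∈ prefixOnlyFactors u w) (hne : x ≠ w) : x.dropLast ∈ prefixOnlyFactors u w := by
  obtain ⟨hf, hp, huniq⟩ := hx
  have hlen : w.length < x.length :=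
    lt_of_le_of_ne hp.length_le fun h => hne (hp.eq_of_length h).symm
  have hx0 : x ≠ [] := by rintro rfl; simp at hlen
  refine ⟨hf.of_infix (List.dropLast_prefix x).isInfix,
    List.prefix_of_prefix_length_le hp (List.dropLast_prefix x) (by simp; omega), ?_⟩
  rintro t ⟨s, hs⟩ ht
  have h := huniq (t ++ [x.getLast hx0])
    ⟨s, by rw [← List.append_assoc, hs, List.dropLast_append_getLast]⟩
    (ht.trans (List.prefix_append _ _))
  rw [← h, List.dropLast_concat]

theorem IsReturnWord.append {u : ℕ → A} {w v : List A} (hv : IsReturnWord u w v) :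
    v ≠ [] ∧ IsFactor u (v ++ w) ∧ (v ++ w).dropLast ∈ prefixOnlyFactors u w := by
  obtain ⟨j, k, hjk, hj, hk, hbetween, rfl⟩ := hv
  set v := factorAt u j (k - j) with hvdef
  have hvlen : v.length = k - j := length_factorAt _ _ _
  have hv0 : v ≠ [] := by
    intro h
    simp [h] at hvlen
    omega
  have hocc : OccursAt u (v ++ w) j :=
    occursAt_append_iff.2 ⟨occursAt_factorAt _ _ _, by rwa [hvlen, Nat.add_sub_cancel' hjk.le]⟩
  have hdrop : OccursAt u (v ++ w).dropLast j := by
    have h := hocc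
    rw [← List.dropLast_append_getLast (l := v ++ w) (by simp [hv0])] at h
    exact (occursAt_append_iff.1 h).1
  refine ⟨hv0, ⟨j, hocc⟩, ⟨j, hdrop⟩, hj.prefix_of_length_le hdrop (by simp; omega), ?_⟩
  rintro t ⟨s, hs⟩ ⟨q, rfl⟩
  have hlen := congrArg List.length hs
  simp only [List.length_append, List.length_dropLast, hvlen] at hlen
  rw [← hs] at hdrop
  have hw := (occursAt_append_iff.1 (occursAt_append_iff.1 hdrop).2).1
  rcases Nat.eq_zero_or_pos s.length with h | h
  · rw [← hs, List.length_eq_zero_iff.1 h, List.nil_append]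
  · exact absurd hw (hbetween _ (by omega) (by omega))

/-- The tree of prefixes of complete return words of `w` has at most one leaf more than the total
right excess of its internal nodes. -/
theorem ncard_returnWords_le_sum [Finite A] {u : ℕ → A} {w : List A}
    (hfin : (prefixOnlyFactors u w).Finite) :
    ((returnWords u w).ncard : ℤ) ≤ 1 + ∑ x ∈ hfin.toFinset, rightExcess u x := by
  classical
  set T : Finset (List A) := insert w
    (hfin.toFinset.biUnion fun x => (rightExt u x).toFinite.toFinset.image fun b => x ++ [b])
  have hmem : ∀ z, IsFactor u z → z ≠ [] → z.dropLast ∈ prefixOnlyFactors u w → z ∈ T := by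
    intro z hz hz0 hd
    refine Finset.mem_insert_of_mem (Finset.mem_biUnion.2 ⟨z.dropLast, by simpa using hd, ?_⟩)
    refine Finset.mem_image.2 ⟨z.getLast hz0, ?_, List.dropLast_append_getLast hz0⟩
    simpa [rightExt, List.dropLast_append_getLast hz0] using hz
  have hT : (T.card : ℤ) ≤ 1 + ∑ x ∈ hfin.toFinset, ((rightExt u x).ncard : ℤ) := by
    have h : T.card ≤ 1 + ∑ x ∈ hfin.toFinset, (rightExt u x).ncard := by
      refine (Finset.card_insert_le _ _).trans ?_
      rw [add_comm]
      refine Nat.add_le_add_left (Finset.card_biUnion_le.trans (Finset.sum_le_sum fun x _ => ?_)) 1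
      rw [Set.ncard_eq_toFinset_card _ (Set.toFinite (rightExt u x))]
      exact Finset.card_image_le
    exact_mod_cast h
  have hL : (· ++ w) '' returnWords u w ⊆ T \ hfin.toFinset := by
    rintro _ ⟨v, hv, rfl⟩
    obtain ⟨hv0, hf, hd⟩ := IsReturnWord.append hv
    refine ⟨hmem _ hf (by simp [hv0]) hd, fun h => hv0 ?_⟩
    have h := (hfin.mem_toFinset.1 h).2.2 w (List.suffix_append v w) List.prefix_rfl
    simpa using h
  have hI : hfin.toFinset ⊆ T := by
    intro x hx
    rw [Set.Finite.mem_toFinset] at hx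
    by_cases hxw : x = w
    · exact hxw ▸ Finset.mem_insert_self _ _
    · refine hmem x hx.1 ?_ (dropLast_mem_prefixOnlyFactors hx hxw)
      rintro rfl
      exact hxw (List.prefix_nil.1 hx.2.1).symm
  rw [← Finset.coe_sdiff] at hL
  have hcard := Set.ncard_le_ncard hL (Finset.finite_toSet _)
  rw [Set.ncard_image_of_injective _ (List.append_left_injective w), Set.ncard_coe_finset,
    Finset.card_sdiff_of_subset hI] at hcard
  have := Finset.card_le_card hI
  simp only [rightExcess, Finset.sum_sub_distrib, Finset.sum_const, nsmul_eq_mul, mul_one]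
  omega

/-- If `u` is uniformly recurrent with no weak bispecial factor and
`ΔC(n) < m` for all `n ≥ 0`, then `#R(w) ≤ m` for every factor `w` of `u`. -/
theorem card_returnWords_le [Fintype A] (u : ℕ → A) (m : ℕ)
    (hur : UniformlyRecurrent u) (hwb : ∀ w, ¬ WeakBispecial u w)
    (hΔ : ∀ n : ℕ, (Complexity u (n + 1) : ℤ) - (Complexity u n : ℤ) < m) :
    ∀ w, IsFactor u w → (returnWords u w).ncard ≤ m := by
  classical
  intro w hw
  obtain ⟨N, hN⟩ := hur.exists_length_le hw
  have hfin : (prefixOnlyFactors u w).Finite :=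
    (List.finite_length_le A N).subset fun x hx => hN x hx
  have hdisj : (hfin.toFinset : Set (List A)).PairwiseDisjoint
      fun x => (factorsOfLength u N).filter (x <:+ ·) := by
    intro x hx y hy hxy
    refine Finset.disjoint_left.2 fun z hzx hzy => hxy ?_
    rw [Finset.mem_coe, Set.Finite.mem_toFinset] at hx hy
    rcases List.suffix_or_suffix_of_suffix (Finset.mem_filter.1 hzx).2
      (Finset.mem_filter.1 hzy).2 with h | h
    · exact hy.2.2 x h hx.2.1
    · exact (hx.2.2 y h hy.2.1).symm
  have hsum : ∑ x ∈ hfin.toFinset, rightExcess u x ≤ ∑ z ∈ factorsOfLength u N, rightExcess u z :=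
    calc ∑ x ∈ hfin.toFinset, rightExcess u x
        ≤ ∑ x ∈ hfin.toFinset, ∑ z ∈ factorsOfLength u N with x <:+ z, rightExcess u z := by
          refine Finset.sum_le_sum fun x hx => ?_
          rw [Set.Finite.mem_toFinset] at hx
          exact rightExcess_le_sum_suffix hwb hx.1 (hN x hx)
      _ = ∑ z ∈ hfin.toFinset.biUnion fun x => (factorsOfLength u N).filter (x <:+ ·),
            rightExcess u z := (Finset.sum_biUnion hdisj).symm
      _ ≤ ∑ z ∈ factorsOfLength u N, rightExcess u z := by
          refine Finset.sum_le_sum_of_subset_of_nonneg ?_ fun z hz _ =>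
            (mem_factorsOfLength.1 hz).2.rightExcess_nonneg
          exact Finset.biUnion_subset.2 fun x _ => Finset.filter_subset _ _
  have hΔN := hΔ N
  rw [complexity_succ_sub] at hΔN
  have := ncard_returnWords_le_sum hfin
  omega
end
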